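/- Let M_1, …, M_k be r×r complex matrices that are simultaneously diagonalizable: there exist an invertible r×r matrix P and diagonal matrices D_1, …, D_k with P⁻¹ M_j P = D_j for all j. Let ξ ∈ ℂ^k be such that the diagonal entries of Σ_{j=1}^k ξ_j D_j are pairwise distinct, and set L = Σ_{j=1}^k ξ_j M_j. If Q is an r×r unitary matrix such that Q* L Q is upper triangular (a Schur decomposition of L), then there exists a permutation σ of {1, …, r} such that for every i and every j, q_i* M_j q_i = (D_j)(σ(i), σ(i)), where q_i denotes the i-th column of Q. In particular, the vectors (q_i* M_1 q_i, …, q_i* M_k q_i), i = 1, …, r, recover the joint eigenvalue tuples of (M_1, …, M_k) up to a common permutation. -/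

import Mathlib

open scoped Matrix

open Polynomial in
theorem SemiconjBy.aeval_right {R A : Type*} [CommSemiring R] [Semiring A] [Algebra R A]
    {w a b : A} (h : SemiconjBy w a b) (p : R[X]) : SemiconjBy w (aeval a p) (aeval b p) := by
  induction p using Polynomial.induction_on' with
  | add p q hp hq => simpa using hp.add_right hq
  | monomial n c =>
    simp only [aeval_monomial]
    exact SemiconjBy.mul_right (Algebra.commutes c w).symm (h.pow_right n)

namespace Matrix

open Polynomial

variable {n R : Type*} [Fintype n]

theorem IsUpperTriangular.mul_apply_diag [LinearOrder n] [NonUnitalNonAssocSemiring R]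
    {A B : Matrix n n R} (hA : A.IsUpperTriangular) (hB : B.IsUpperTriangular) (i : n) :
    (A * B) i i = A i i * B i i := by
  rw [mul_apply]
  refine Finset.sum_eq_single i (fun b _ hb => ?_) (by simp)
  rcases lt_or_gt_of_ne hb with hlt | hgt
  · rw [hA hlt, zero_mul]
  · rw [hB hgt, mul_zero]

variable [DecidableEq n]

theorem IsUpperTriangular.pow_apply_diag [LinearOrder n] [Semiring R]
    {A : Matrix n n R} (hA : A.IsUpperTriangular) (k : ℕ) (i : n) :
    (A ^ k) i i = A i i ^ k := by
  induction k with
  | zero => simp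
  | succ k ih => rw [pow_succ, IsUpperTriangular.mul_apply_diag (hA.pow k) hA, ih, pow_succ]

theorem IsUpperTriangular.aeval_apply_diag [LinearOrder n] [CommSemiring R]
    {A : Matrix n n R} (hA : A.IsUpperTriangular) (p : R[X]) (i : n) :
    (aeval A p) i i = p.eval (A i i) := by
  induction p using Polynomial.induction_on' with
  | add p q hp hq => simp [hp, hq]
  | monomial k c =>
    rw [aeval_monomial, ← Algebra.smul_def, smul_apply, IsUpperTriangular.pow_apply_diag hA,
      eval_monomial, smul_eq_mul]

theorem aeval_diagonal [CommSemiring R] (d : n → R) (p : R[X]) :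
    aeval (diagonal d) p = diagonal fun i => p.eval (d i) := by
  have h := aeval_algHom_apply (diagonalAlgHom R (α := R) (n := n)) d p
  simpa [aeval_pi_apply] using h

/-- The eigenvalues of an upper triangular matrix similar to `diagonal d`, with `d` injective,
are the entries of `d` in some order. -/
theorem IsUpperTriangular.exists_perm_diag_eq [LinearOrder n] [CommRing R] [IsDomain R]
    {A : Matrix n n R} (hA : A.IsUpperTriangular) {d : n → R} (hd : Function.Injective d)
    (h : A.charpoly = (diagonal d).charpoly) :
    ∃ σ : Equiv.Perm n, ∀ i, A i i = d (σ i) := by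
  rw [charpoly_of_isUpperTriangular A hA, charpoly_diagonal] at h
  have mem (x : R) : (∃ i, x = A i i) ↔ ∃ i, x = d i := by
    have hx := congrArg (fun p => eval x p = 0) h
    simpa [eval_prod, Finset.prod_eq_zero_iff, sub_eq_zero] using hx
  choose f hf using fun i => (mem (A i i)).1 ⟨i, rfl⟩
  have hsurj : Function.Surjective f := fun a => by
    obtain ⟨i, hi⟩ := (mem (d a)).2 ⟨a, rfl⟩
    exact ⟨i, hd ((hf i).symm.trans hi.symm)⟩
  exact ⟨Equiv.ofBijective f (Finite.injective_iff_bijective.1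
    (Finite.injective_iff_surjective.2 hsurj)), hf⟩

end Matrix

/-- Schur decomposition of a generic combination of simultaneously
diagonalizable matrices recovers the joint eigenvalue tuples: if
`P⁻¹ M_j P = D_j` (diagonal) for all `j`, the diagonal entries of
`Σ_j ξ_j D_j` are pairwise distinct, and `Q` is unitary with
`Q* (Σ_j ξ_j M_j) Q` upper triangular, then there is a permutation `σ` with
`q_i* M_j q_i = (D_j)(σ i, σ i)` for all `i, j`, where `q_i` is the `i`-th
column of `Q`. -/
theorem schur_recovers_joint_eigenvalues
    (k r : ℕ) (M : Fin k → Matrix (Fin r) (Fin r) ℂ)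
    (P : Matrix (Fin r) (Fin r) ℂ) (hP : IsUnit P)
    (D : Fin k → Matrix (Fin r) (Fin r) ℂ)
    (hDdiag : ∀ (j : Fin k) (a b : Fin r), a ≠ b → D j a b = 0)
    (hdiag : ∀ j : Fin k, P⁻¹ * M j * P = D j)
    (ξ : Fin k → ℂ)
    (hdist : Function.Injective fun a : Fin r => ∑ j : Fin k, ξ j * D j a a)
    (Q : Matrix (Fin r) (Fin r) ℂ)
    (hQ : Qᴴ * Q = 1)
    (hT : ∀ a b : Fin r, b < a → (Qᴴ * (∑ j : Fin k, ξ j • M j) * Q) a b = 0) :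
    ∃ σ : Equiv.Perm (Fin r), ∀ (i : Fin r) (j : Fin k),
      (∑ a : Fin r, ∑ b : Fin r,
        (starRingEnd ℂ) (Q a i) * M j a b * Q b i) = D j (σ i) (σ i) := by
  have hPdet : IsUnit P.det := P.isUnit_iff_isUnit_det.1 hP
  have hQ' : Q * Qᴴ = 1 := mul_eq_one_comm.1 hQ
  let W : (Matrix (Fin r) (Fin r) ℂ)ˣ :=
    { val := Qᴴ * P
      inv := P⁻¹ * Q
      val_inv := by
        rw [Matrix.mul_assoc, Matrix.mul_nonsing_inv_cancel_left _ _ hPdet, hQ]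
      inv_val := by
        rw [Matrix.mul_assoc, ← Matrix.mul_assoc Q, hQ', Matrix.one_mul,
          Matrix.nonsing_inv_mul _ hPdet] }
  have hconj (A B : Matrix (Fin r) (Fin r) ℂ) (h : P⁻¹ * A * P = B) :
      Qᴴ * A * Q = W.val * B * W.inv := by
    have hPP := Matrix.mul_nonsing_inv P hPdet
    calc Qᴴ * A * Q = Qᴴ * (P * P⁻¹) * A * (P * P⁻¹) * Q := by simp [hPP]
      _ = W.val * B * W.inv := by simp only [W, ← h, Matrix.mul_assoc]
  set d : Fin r → ℂ := fun a => ∑ j, ξ j * D j a a with hd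
  have hD (j : Fin k) : D j = Matrix.diagonal fun a => D j a a := by
    ext a b
    by_cases hab : a = b
    · simp [hab]
    · rw [hDdiag j a b hab, Matrix.diagonal_apply_ne _ hab]
  have hL : P⁻¹ * (∑ j, ξ j • M j) * P = Matrix.diagonal d := by
    simp only [Matrix.mul_sum, Matrix.sum_mul, Matrix.mul_smul, Matrix.smul_mul, hdiag]
    ext a b
    by_cases hab : a = b
    · simp [hab, hd, Matrix.sum_apply]
    · simp [hab, Matrix.sum_apply, hDdiag _ a b hab]
  set T := Qᴴ * (∑ j, ξ j • M j) * Q with hTdef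
  have hTW : T = W.val * Matrix.diagonal d * W.inv := hconj _ _ hL
  have hTtri : T.IsUpperTriangular := fun a b hab => hT a b hab
  obtain ⟨σ, hσ⟩ := hTtri.exists_perm_diag_eq hdist
    (by rw [hTW, Units.inv_eq_val_inv, Matrix.coe_units_inv, Matrix.charpoly_units_conj W])
  refine ⟨σ, fun i j => ?_⟩
  obtain ⟨p, hp⟩ : ∃ p : Polynomial ℂ, ∀ a, p.eval (d a) = D j a a :=
    ⟨Lagrange.interpolate Finset.univ d fun a => D j a a, fun a =>
      Lagrange.eval_interpolate_at_node _ hdist.injOn (Finset.mem_univ a)⟩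
  have hsemi : SemiconjBy W.val (Matrix.diagonal d) T := by
    rw [hTW, SemiconjBy, Matrix.mul_assoc _ W.inv, W.inv_val, Matrix.mul_one]
  have hMT : Qᴴ * M j * Q = Polynomial.aeval T p := by
    have h := (hsemi.aeval_right p).eq
    rw [Matrix.aeval_diagonal, funext hp, ← hD] at h
    rw [hconj _ _ (hdiag j), h, Matrix.mul_assoc, W.val_inv, Matrix.mul_one]
  calc _ = (Qᴴ * M j * Q) i i := by
        simp only [Matrix.mul_apply, Matrix.conjTranspose_apply, Finset.sum_mul]
        exact Finset.sum_comm
    _ = D j (σ i) (σ i) := by rw [hMT, hTtri.aeval_apply_diag, hσ, hp]
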